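/- Let n ≥ 1, k ≥ 2, and let X_1, …, X_{nk} be jointly distributed random variables, each taking values in a finite set. For r ∈ [k] let A_r = {n(r−1)+1, …, nr}, let σ be a uniformly random permutation of [nk], and write σ(A) = {σ(i) : i ∈ A}. Then E_σ[ Σ_{r=1}^k φ( X_{σ(A_r)} | X_{σ(A_1 ∪ ⋯ ∪ A_{r−1})} ) ] ≤ (1/k)·φ(X_{[nk]}). -/

import Mathlib

open MeasureTheory

/-- Shannon entropy (natural log) of a finitely-valued random variable `f`
on the probability space `(Ω, μ)`: `H(f) = -∑ b P(f = b) log P(f = b)`. -/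
noncomputable def fentropy {Ω β : Type*} [MeasurableSpace Ω] [Fintype β]
    (μ : Measure Ω) (f : Ω → β) : ℝ :=
  ∑ b : β, Real.negMulLog ((μ (f ⁻¹' {b})).toReal)

/-- Mutual information `I(f ; g) = H(f) + H(g) - H(f, g)`. -/
noncomputable def fmutualInfo {Ω β γ : Type*} [MeasurableSpace Ω] [Fintype β] [Fintype γ]
    (μ : Measure Ω) (f : Ω → β) (g : Ω → γ) : ℝ :=
  fentropy μ f + fentropy μ g - fentropy μ (fun ω => (f ω, g ω))

/-- Conditional mutual information
`I(f ; g | h) = H(f, h) + H(g, h) - H(f, g, h) - H(h)`. -/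
noncomputable def fcondMutualInfo {Ω β γ δ : Type*} [MeasurableSpace Ω]
    [Fintype β] [Fintype γ] [Fintype δ]
    (μ : Measure Ω) (f : Ω → β) (g : Ω → γ) (h : Ω → δ) : ℝ :=
  fentropy μ (fun ω => (f ω, h ω)) + fentropy μ (fun ω => (g ω, h ω))
    - fentropy μ (fun ω => (f ω, g ω, h ω)) - fentropy μ h

/-- The potential `φ(X_S) = ∑_{i ∈ S} I(X_i ; X_{S \ {i}})`. -/
noncomputable def fphi {Ω ι : Type*} [MeasurableSpace Ω] [DecidableEq ι]
    {α : ι → Type*} [∀ i, Fintype (α i)]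
    (μ : Measure Ω) (X : ∀ i, Ω → α i) (S : Finset ι) : ℝ :=
  ∑ i ∈ S, fmutualInfo μ (X i) (fun ω (j : {j // j ∈ S.erase i}) => X j.1 ω)

/-- The conditional potential `φ(X_S | Y) = ∑_{i ∈ S} I(X_i ; X_{S \ {i}} | Y)`. -/
noncomputable def fphiCond {Ω ι δ : Type*} [MeasurableSpace Ω] [DecidableEq ι]
    {α : ι → Type*} [∀ i, Fintype (α i)] [Fintype δ]
    (μ : Measure Ω) (X : ∀ i, Ω → α i) (S : Finset ι) (Y : Ω → δ) : ℝ :=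
  ∑ i ∈ S, fcondMutualInfo μ (X i) (fun ω (j : {j // j ∈ S.erase i}) => X j.1 ω) Y

lemma exists_of_fiber_ne_zero {Ω β : Type*} [MeasurableSpace Ω]
    (μ : Measure Ω) {f : Ω → β} {b : β}
    (hb : Real.negMulLog ((μ (f ⁻¹' {b})).toReal) ≠ 0) : ∃ ω, f ω = b := by
  by_contra! h
  have : f ⁻¹' {b} = ∅ := by
    ext ω
    simpa using h ω
  simp [this] at hb

/-- Two random variables with the same fibres have the same entropy. -/
lemma fentropy_congr {Ω β γ : Type*} [MeasurableSpace Ω] [Fintype β] [Fintype γ]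
    (μ : Measure Ω) {f : Ω → β} {g : Ω → γ} (h : ∀ x y, f x = f y ↔ g x = g y) :
    fentropy μ f = fentropy μ g := by
  have key (c : Ω) : f ⁻¹' {f c} = g ⁻¹' {g c} := by
    ext x
    simpa using h x c
  unfold fentropy
  refine Finset.sum_bij_ne_zero (fun b _ hb => g (exists_of_fiber_ne_zero μ hb).choose)
    ?_ ?_ ?_ ?_
  · intros
    exact Finset.mem_univ _
  · intro b₁ _ h₁ b₂ _ h₂ e
    rw [← (exists_of_fiber_ne_zero μ h₁).choose_spec,
      ← (exists_of_fiber_ne_zero μ h₂).choose_spec]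
    exact (h _ _).2 e
  · intro c _ hc
    obtain ⟨ω, rfl⟩ := exists_of_fiber_ne_zero μ hc
    rw [← key] at hc
    exact ⟨f ω, Finset.mem_univ _, hc,
      (h _ _).1 (exists_of_fiber_ne_zero μ hc).choose_spec⟩
  · intro b _ hb
    rw [← key, (exists_of_fiber_ne_zero μ hb).choose_spec]

/-- The pointwise inequality behind nonnegativity of conditional mutual information. -/
lemma sub_div_le_mul_log {p a b c : ℝ} (hp : 0 ≤ p) (ha : p ≤ a) (hb : p ≤ b) (hc : p ≤ c) :
    p - a * b / c ≤ p * (Real.log p + Real.log c - Real.log a - Real.log b) := by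
  rcases hp.eq_or_lt with rfl | hp
  · have : 0 ≤ a * b / c := by positivity
    simpa using this
  have ha' := hp.trans_le ha
  have hb' := hp.trans_le hb
  have hc' := hp.trans_le hc
  have h := Real.one_sub_inv_le_log_of_pos (show 0 < p * c / (a * b) by positivity)
  rw [Real.log_div (by positivity) (by positivity), Real.log_mul hp.ne' hc'.ne',
    Real.log_mul ha'.ne' hb'.ne'] at h
  have h' := mul_le_mul_of_nonneg_left h hp.le
  have e : p * (1 - (p * c / (a * b))⁻¹) = p - a * b / c := by field_simp
  rw [e] at h'
  linarith

/-- Shannon's inequality for a nonnegative function on a finite product. -/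
lemma sum_negMulLog_submodular {α β γ : Type*} [Fintype α] [Fintype β] [Fintype γ]
    (p : α → β → γ → ℝ) (hp : ∀ x y z, 0 ≤ p x y z) :
    (∑ x, ∑ y, ∑ z, Real.negMulLog (p x y z)) + ∑ z, Real.negMulLog (∑ x, ∑ y, p x y z) ≤
      (∑ x, ∑ z, Real.negMulLog (∑ y, p x y z)) + ∑ y, ∑ z, Real.negMulLog (∑ x, p x y z) := by
  have hfiber (z : γ) : (∑ x, ∑ y, Real.negMulLog (p x y z))
      + Real.negMulLog (∑ x, ∑ y, p x y z) ≤
      (∑ x, Real.negMulLog (∑ y, p x y z)) + ∑ y, Real.negMulLog (∑ x, p x y z) := by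
    set c := ∑ x, ∑ y, p x y z with hc
    set a : α → ℝ := fun x => ∑ y, p x y z
    set b : β → ℝ := fun y => ∑ x, p x y z
    have hca : ∑ x, a x = c := rfl
    have hcb : ∑ y, b y = c := Finset.sum_comm
    have h0 : ∑ x, ∑ y, (p x y z - a x * b y / c) = 0 := by
      simp_rw [Finset.sum_sub_distrib, mul_div_assoc, ← Finset.mul_sum, ← Finset.sum_mul,
        ← Finset.sum_div]
      rw [hcb, ← hc, ← mul_div_assoc, mul_self_div_self, sub_self]
    have h1 : ∑ x, ∑ y, (p x y z - a x * b y / c) ≤ ∑ x, ∑ y, p x y z *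
        (Real.log (p x y z) + Real.log c - Real.log (a x) - Real.log (b y)) := by
      refine Finset.sum_le_sum fun x _ => Finset.sum_le_sum fun y _ => ?_
      have hpa : p x y z ≤ a x :=
        Finset.single_le_sum (f := fun y => p x y z) (fun y _ => hp x y z) (Finset.mem_univ y)
      refine sub_div_le_mul_log (hp x y z) hpa ?_ (hpa.trans ?_)
      · exact Finset.single_le_sum (f := fun x => p x y z) (fun x _ => hp x y z)
          (Finset.mem_univ x)
      · exact Finset.single_le_sum (f := a)
          (fun x _ => Finset.sum_nonneg fun y _ => hp x y z) (Finset.mem_univ x)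
    have ec : ∑ x, ∑ y, p x y z * Real.log c = c * Real.log c := by
      simp_rw [← Finset.sum_mul]
      rfl
    have ea : ∑ x, ∑ y, p x y z * Real.log (a x) = ∑ x, a x * Real.log (a x) := by
      simp_rw [← Finset.sum_mul]
      rfl
    have eb : ∑ x, ∑ y, p x y z * Real.log (b y) = ∑ y, b y * Real.log (b y) := by
      rw [Finset.sum_comm]
      simp_rw [← Finset.sum_mul]
      rfl
    simp_rw [mul_sub, mul_add, Finset.sum_sub_distrib, Finset.sum_add_distrib] at h1
    rw [ec, ea, eb] at h1
    simp_rw [Real.negMulLog, neg_mul, Finset.sum_neg_distrib]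
    simp_rw [Finset.sum_sub_distrib] at h0
    linarith
  have hsum := Finset.sum_le_sum fun z (_ : z ∈ Finset.univ) => hfiber z
  simp only [Finset.sum_add_distrib] at hsum
  have e1 : ∑ x, ∑ y, ∑ z, Real.negMulLog (p x y z)
      = ∑ z, ∑ x, ∑ y, Real.negMulLog (p x y z) := by
    rw [Finset.sum_comm (s := (Finset.univ : Finset γ))]
    exact Finset.sum_congr rfl fun x _ => Finset.sum_comm
  have e2 : ∑ x, ∑ z, Real.negMulLog (∑ y, p x y z)
      = ∑ z, ∑ x, Real.negMulLog (∑ y, p x y z) := Finset.sum_comm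
  have e3 : ∑ y, ∑ z, Real.negMulLog (∑ x, p x y z)
      = ∑ z, ∑ y, Real.negMulLog (∑ x, p x y z) := Finset.sum_comm
  rw [e1, e2, e3]
  exact hsum

/-- Splitting the measure of a set along the fibres of a finitely-valued random variable. -/
lemma sum_measure_inter_fiber {Ω β : Type*} [MeasurableSpace Ω] [Fintype β]
    (μ : Measure Ω) [IsFiniteMeasure μ] {f : Ω → β} (hf : ∀ b, MeasurableSet (f ⁻¹' {b}))
    (s : Set Ω) : ∑ b, (μ (s ∩ f ⁻¹' {b})).toReal = (μ s).toReal := by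
  rw [← ENNReal.toReal_sum (fun b _ => measure_ne_top _ _)]
  congr 1
  have h := sum_measure_preimage_singleton (μ := μ.restrict s) (f := f) Finset.univ
    (fun b _ => hf b)
  simpa only [fun b => Measure.restrict_apply (μ := μ) (s := s) (hf b), Finset.coe_univ,
    Set.preimage_univ, Measure.restrict_apply_univ, Set.inter_comm] using h

lemma fcondMutualInfo_nonneg {Ω β γ δ : Type*} [MeasurableSpace Ω]
    [Fintype β] [Fintype γ] [Fintype δ] (μ : Measure Ω) [IsFiniteMeasure μ]
    {f : Ω → β} {g : Ω → γ} (h : Ω → δ) (hf : ∀ b, MeasurableSet (f ⁻¹' {b}))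
    (hg : ∀ c, MeasurableSet (g ⁻¹' {c})) : 0 ≤ fcondMutualInfo μ f g h := by
  let p : β → γ → δ → ℝ := fun b c d => (μ (h ⁻¹' {d} ∩ f ⁻¹' {b} ∩ g ⁻¹' {c})).toReal
  have main := sum_negMulLog_submodular p fun _ _ _ => ENNReal.toReal_nonneg
  have e1 (b : β) (d : δ) : ∑ c, p b c d = (μ ((fun ω => (f ω, h ω)) ⁻¹' {(b, d)})).toReal := by
    simp_rw [p, sum_measure_inter_fiber μ hg]
    congr 2
    ext ω
    simp [and_comm]
  have e2 (c : γ) (d : δ) : ∑ b, p b c d = (μ ((fun ω => (g ω, h ω)) ⁻¹' {(c, d)})).toReal := by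
    simp_rw [p, Set.inter_right_comm _ _ (g ⁻¹' {c}), sum_measure_inter_fiber μ hf]
    congr 2
    ext ω
    simp [and_comm]
  have e3 (d : δ) : ∑ b, ∑ c, p b c d = (μ (h ⁻¹' {d})).toReal := by
    simp_rw [p, sum_measure_inter_fiber μ hg, sum_measure_inter_fiber μ hf]
  have e4 (b : β) (c : γ) (d : δ) :
      p b c d = (μ ((fun ω => (f ω, g ω, h ω)) ⁻¹' {(b, c, d)})).toReal := by
    simp_rw [p]
    congr 2
    ext
    simp only [Set.mem_inter_iff, Set.mem_preimage, Set.mem_singleton_iff, Prod.mk.injEq]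
    tauto
  simp_rw [e3, e1, e2, e4] at main
  simp only [fcondMutualInfo, fentropy, Fintype.sum_prod_type]
  linarith

section JointEntropy

variable {Ω ι : Type*} [MeasurableSpace Ω] [DecidableEq ι] {α : ι → Type*} [∀ i, Fintype (α i)]
  (μ : Measure Ω) (X : ∀ i, Ω → α i)

/-- The joint entropy `H(X_S)`. -/
noncomputable def jointEntropy (S : Finset ι) : ℝ :=
  fentropy μ (fun ω (j : {j // j ∈ S}) => X j.1 ω)

lemma jointEntropy_empty [IsProbabilityMeasure μ] : jointEntropy μ X ∅ = 0 := by
  have h := fentropy_congr μ (f := fun ω (j : {j // j ∈ (∅ : Finset ι)}) => X j.1 ω)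
    (g := fun _ => ()) (by simp [funext_iff])
  rw [jointEntropy, h]
  simp [fentropy]

lemma fcondMutualInfo_eq_jointEntropy (i : ι) (S B : Finset ι) :
    fcondMutualInfo μ (X i) (fun ω (j : {j // j ∈ S}) => X j.1 ω)
        (fun ω (j : {j // j ∈ B}) => X j.1 ω) =
      jointEntropy μ X (insert i B) + jointEntropy μ X (S ∪ B)
        - jointEntropy μ X (insert i S ∪ B) - jointEntropy μ X B := by
  unfold fcondMutualInfo jointEntropy
  congr 1
  congr 1
  · congr 1 <;> apply fentropy_congr <;> intro x y <;>
      simp only [Prod.mk.injEq, funext_iff, Subtype.forall, Finset.mem_insert,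
        Finset.mem_union, or_imp, forall_and, forall_eq]
  · apply fentropy_congr
    intro x y
    simp only [Prod.mk.injEq, funext_iff, Subtype.forall, Finset.mem_insert,
        Finset.mem_union, or_imp, forall_and, forall_eq, and_assoc]

lemma fphiCond_eq_jointEntropy (S B : Finset ι) :
    fphiCond μ X S (fun ω (j : {j // j ∈ B}) => X j.1 ω) =
      ∑ i ∈ S, (jointEntropy μ X (insert i B) + jointEntropy μ X (S.erase i ∪ B)
        - jointEntropy μ X (S ∪ B) - jointEntropy μ X B) := by
  refine Finset.sum_congr rfl fun i hi => ?_
  rw [fcondMutualInfo_eq_jointEntropy, Finset.insert_erase hi]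

lemma fphi_eq_fphiCond_empty [IsProbabilityMeasure μ] (S : Finset ι) :
    fphi μ X S = fphiCond μ X S (fun ω (j : {j // j ∈ (∅ : Finset ι)}) => X j.1 ω) := by
  refine Finset.sum_congr rfl fun i hi => ?_
  have h0 := jointEntropy_empty μ X
  unfold jointEntropy at h0
  unfold fmutualInfo fcondMutualInfo
  rw [h0, sub_zero]
  congr 1
  · congr 1 <;> apply fentropy_congr <;> intro x y <;> simp [funext_iff]
  · apply fentropy_congr
    intro x y
    simp [funext_iff]

lemma jointEntropy_submodular [IsFiniteMeasure μ] [∀ i, MeasurableSpace (α i)]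
    [∀ i, MeasurableSingletonClass (α i)] (hX : ∀ i, Measurable (X i)) (i j : ι) (S : Finset ι) :
    jointEntropy μ X (insert i (insert j S)) + jointEntropy μ X S ≤
      jointEntropy μ X (insert i S) + jointEntropy μ X (insert j S) := by
  have h := fcondMutualInfo_nonneg μ (f := X i) (g := fun ω (l : {l // l ∈ ({j} : Finset ι)}) =>
    X l.1 ω) (fun ω (l : {l // l ∈ S}) => X l.1 ω)
    (fun b => hX i (measurableSet_singleton b))
    (fun c => (measurable_pi_lambda _ fun l : {l // l ∈ ({j} : Finset ι)} => hX l.1)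
      (measurableSet_singleton c))
  rw [fcondMutualInfo_eq_jointEntropy, Finset.insert_union, ← Finset.insert_eq] at h
  linarith

end JointEntropy

section PermSum

variable {ι : Type*} [Fintype ι] [DecidableEq ι] (F : Finset ι → ℝ)

/-- The sum of a set function over all images of `S` under permutations. -/
noncomputable def permSum (S : Finset ι) : ℝ := ∑ σ : Equiv.Perm ι, F (S.image σ)

lemma permSum_eq_of_card_eq {S T : Finset ι} (h : S.card = T.card) :
    permSum F S = permSum F T := by
  obtain ⟨τ, hτ⟩ : ∃ τ : Equiv.Perm ι, S.image τ = T := by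
    let e : {x // x ∈ S} ≃ {x // x ∈ T} := Finset.equivOfCardEq h
    refine ⟨e.extendSubtype, Finset.eq_of_subset_of_card_le ?_ ?_⟩
    · intro x hx
      obtain ⟨y, hy, rfl⟩ := Finset.mem_image.1 hx
      exact e.extendSubtype_mem y hy
    · rw [Finset.card_image_of_injective _ (Equiv.injective _), h]
  unfold permSum
  rw [← Equiv.sum_comp (Equiv.mulRight τ) (fun σ : Equiv.Perm ι => F (S.image σ))]
  refine Finset.sum_congr rfl fun σ _ => ?_
  rw [← hτ, Finset.image_image]
  rfl

lemma sum_perm_sum_image (S B : Finset ι) :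
    ∑ σ : Equiv.Perm ι, ∑ i ∈ S.image σ, (F (insert i (B.image σ))
        + F ((S.image σ).erase i ∪ B.image σ) - F (S.image σ ∪ B.image σ) - F (B.image σ)) =
      ∑ i ∈ S, (permSum F (insert i B) + permSum F (S.erase i ∪ B)
        - permSum F (S ∪ B) - permSum F B) := by
  simp_rw [permSum, ← Finset.sum_add_distrib, ← Finset.sum_sub_distrib]
  rw [Finset.sum_comm]
  refine Finset.sum_congr rfl fun σ _ => ?_
  rw [Finset.sum_image σ.injective.injOn]
  refine Finset.sum_congr rfl fun i _ => ?_
  rw [Finset.image_insert, Finset.image_union, Finset.image_union,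
    Finset.image_erase σ.injective]

end PermSum

/-- For a concave sequence, the drops of the increments over blocks of length `n` add up to at
most the total drop. -/
lemma sum_block_drop_le {n k : ℕ} (hn : 1 ≤ n) (a : ℕ → ℝ)
    (ha : ∀ m, m + 2 ≤ n * k → a (m + 2) + a m ≤ a (m + 1) + a (m + 1)) {m : ℕ}
    (hm : m + 1 ≤ k) :
    ∑ r ∈ Finset.range (m + 1),
        (a (n * r + 1) + a (n * (r + 1) - 1) - a (n * (r + 1)) - a (n * r)) ≤
      a 1 + a (n * (m + 1) - 1) - a (n * (m + 1)) - a 0 := by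
  induction m with
  | zero => simp
  | succ m ih =>
    rw [Finset.sum_range_succ]
    have h := ih (by omega)
    obtain ⟨t, ht⟩ : ∃ t, n * (m + 1) = t + 1 :=
      Nat.exists_eq_add_one.2 (by positivity)
    have hle : t + 2 ≤ n * k := by
      have h1 : n * (m + 1 + 1) ≤ n * k := Nat.mul_le_mul_left n hm
      have h2 : n * (m + 1 + 1) = n * (m + 1) + n := by ring
      omega
    have hc := ha t hle
    rw [ht] at h ⊢
    simp only [Nat.add_sub_cancel] at h
    linarith

/-- new pinning lemma, `k` blocks. For a uniformly random permutation `σ`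
of `[nk]`, with `A_r = {n(r-1)+1,…,nr}`,
`E_σ[ ∑_{r=1}^k φ(X_{σ(A_r)} | X_{σ(A_1 ∪ ⋯ ∪ A_{r-1})}) ] ≤ (1/k) φ(X_{[nk]})`. -/
theorem pinning_lemma_k_blocks {Ω : Type*} [MeasurableSpace Ω] (μ : Measure Ω)
    [IsProbabilityMeasure μ] {n k : ℕ} (hn : 1 ≤ n) (hk : 2 ≤ k)
    (α : Fin (n * k) → Type*) [∀ i, Fintype (α i)]
    [∀ i, MeasurableSpace (α i)] [∀ i, MeasurableSingletonClass (α i)]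
    (X : ∀ i, Ω → α i) (hX : ∀ i, Measurable (X i)) :
    (Fintype.card (Equiv.Perm (Fin (n * k))) : ℝ)⁻¹ *
        ∑ σ : Equiv.Perm (Fin (n * k)),
          ∑ r : Fin k,
            fphiCond μ X
              (Finset.image σ ((Finset.univ : Finset (Fin (n * k))).filter
                (fun i => n * (r : ℕ) ≤ (i : ℕ) ∧ (i : ℕ) < n * ((r : ℕ) + 1))))
              (fun ω (j : {j // j ∈ Finset.image σ ((Finset.univ : Finset (Fin (n * k))).filter
                (fun i => (i : ℕ) < n * (r : ℕ)))}) => X j.1 ω) ≤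
      (k : ℝ)⁻¹ * fphi μ X (Finset.univ : Finset (Fin (n * k))) := by
  let F := jointEntropy μ X
  let P : ℕ → Finset (Fin (n * k)) := fun m => Finset.univ.filter fun i => (i : ℕ) < m
  let a : ℕ → ℝ := fun m => permSum F (P m)
  have hcard {m : ℕ} (hm : m ≤ n * k) : (P m).card = m := by
    simp [P, Fin.card_filter_val_lt, hm]
  have hperm {m : ℕ} {S : Finset (Fin (n * k))} (hm : m ≤ n * k) (hS : S.card = m) :
      permSum F S = a m := permSum_eq_of_card_eq F (hS.trans (hcard hm).symm)
  have hblock {m l : ℕ} (hml : m + l ≤ n * k) {S B : Finset (Fin (n * k))}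
      (hS : S.card = l) (hB : B.card = m) (hSB : Disjoint S B) :
      ∑ σ : Equiv.Perm (Fin (n * k)), fphiCond μ X (S.image σ)
          (fun ω (j : {j // j ∈ B.image σ}) => X j.1 ω) =
        l * (a (m + 1) + a (m + l - 1) - a (m + l) - a m) := by
    simp_rw [fphiCond_eq_jointEntropy]
    rw [sum_perm_sum_image, ← hS, ← nsmul_eq_mul]
    refine Finset.sum_eq_card_nsmul fun i hi => ?_
    have hpos : 0 < S.card := Finset.card_pos.2 ⟨i, hi⟩
    have hiB : i ∉ B := Finset.disjoint_left.1 hSB hi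
    rw [hperm (m := m + 1) (by omega) (by rw [Finset.card_insert_of_notMem hiB, hB]),
      hperm (m := m + S.card - 1) (by omega) (by
        rw [Finset.card_union_of_disjoint (hSB.mono_left (Finset.erase_subset _ _)),
          Finset.card_erase_of_mem hi]
        omega),
      hperm (m := m + S.card) (by omega) (by
        rw [Finset.card_union_of_disjoint hSB]
        omega),
      hperm (m := m) (by omega) hB]
  have hconc (m : ℕ) (hm : m + 2 ≤ n * k) : a (m + 2) + a m ≤ a (m + 1) + a (m + 1) := by
    let x : Fin (n * k) := ⟨m, by omega⟩
    let y : Fin (n * k) := ⟨m + 1, by omega⟩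
    have hx : x ∉ P m := by simp [P, x]
    have hy : y ∉ P m := by simp [P, y]
    have hxy : x ∉ insert y (P m) := by simp [P, x, y]
    have hm' := hcard (m := m) (by omega)
    rw [← hperm (S := insert x (insert y (P m))) hm (by
        rw [Finset.card_insert_of_notMem hxy, Finset.card_insert_of_notMem hy, hm'])]
    nth_rw 1 [← hperm (S := insert x (P m)) (m := m + 1) (by omega) (by
        rw [Finset.card_insert_of_notMem hx, hm'])]
    rw [← hperm (S := insert y (P m)) (m := m + 1) (by omega) (by
        rw [Finset.card_insert_of_notMem hy, hm'])]
    simp only [a, permSum, ← Finset.sum_add_distrib]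
    refine Finset.sum_le_sum fun σ _ => ?_
    simp only [Finset.image_insert]
    exact jointEntropy_submodular μ X hX _ _ _
  have hphi : (Fintype.card (Equiv.Perm (Fin (n * k))) : ℝ) * fphi μ X Finset.univ =
      ((n * k : ℕ) : ℝ) * (a 1 + a (n * k - 1) - a (n * k) - a 0) := by
    have h := hblock (m := 0) (l := n * k) (S := Finset.univ) (B := ∅) (by omega) (by simp)
      (by simp) (by simp)
    simp only [fphiCond_eq_jointEntropy] at h
    simp only [Finset.image_empty, zero_add,
      Finset.image_univ_of_surjective (Equiv.surjective _)] at h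
    rw [← h, fphi_eq_fphiCond_empty, fphiCond_eq_jointEntropy, Finset.sum_const,
      Finset.card_univ, nsmul_eq_mul]
  have hsum : ∑ σ : Equiv.Perm (Fin (n * k)), ∑ r : Fin k,
      fphiCond μ X
        (Finset.image σ ((Finset.univ : Finset (Fin (n * k))).filter
          (fun i => n * (r : ℕ) ≤ (i : ℕ) ∧ (i : ℕ) < n * ((r : ℕ) + 1))))
        (fun ω (j : {j // j ∈ Finset.image σ ((Finset.univ : Finset (Fin (n * k))).filter
          (fun i => (i : ℕ) < n * (r : ℕ)))}) => X j.1 ω) =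
      n * ∑ r ∈ Finset.range k,
        (a (n * r + 1) + a (n * (r + 1) - 1) - a (n * (r + 1)) - a (n * r)) := by
    rw [Finset.sum_comm, Finset.mul_sum, ← Fin.sum_univ_eq_sum_range
      (fun r => (n : ℝ) * (a (n * r + 1) + a (n * (r + 1) - 1) - a (n * (r + 1)) - a (n * r)))]
    refine Finset.sum_congr rfl fun r _ => ?_
    have hle : n * ((r : ℕ) + 1) ≤ n * k := Nat.mul_le_mul_left n r.2
    have hadd : n * ((r : ℕ) + 1) = n * r + n := by ring
    let A : Finset (Fin (n * k)) :=
      Finset.univ.filter fun i => n * (r : ℕ) ≤ (i : ℕ) ∧ (i : ℕ) < n * ((r : ℕ) + 1)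
    have hdisj : Disjoint A (P (n * r)) := by
      refine Finset.disjoint_left.2 fun i hi hi' => ?_
      simp only [A, P, Finset.mem_filter_univ] at hi hi'
      omega
    have hunion : A ∪ P (n * r) = P (n * (r + 1)) := by
      ext i
      simp only [A, P, Finset.mem_union, Finset.mem_filter_univ]
      omega
    have hA : A.card = n := by
      have hc := congrArg Finset.card hunion
      rw [Finset.card_union_of_disjoint hdisj, hcard hle, hcard (by omega)] at hc
      omega
    have h := hblock (m := n * r) (l := n) (by omega) hA (hcard (by omega)) hdisj
    rw [← hadd] at h
    exact h
  obtain ⟨m, rfl⟩ : ∃ m, k = m + 1 := ⟨k - 1, by omega⟩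
  have hN : (0 : ℝ) < Fintype.card (Equiv.Perm (Fin (n * (m + 1)))) := by
    exact_mod_cast Fintype.card_pos
  have hk' : (0 : ℝ) < ((m + 1 : ℕ) : ℝ) := by positivity
  have hdrop := mul_le_mul_of_nonneg_left (sum_block_drop_le hn a hconc le_rfl)
    (Nat.cast_nonneg (α := ℝ) n)
  rw [hsum, inv_mul_le_iff₀ hN, mul_left_comm, hphi]
  refine hdrop.trans_eq ?_
  push_cast at hk' ⊢
  field_simp
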